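/- arXiv:1311.7274 — 2 statements merged into one kernel-verified Lean document; each statement's English description precedes it below -/
import Mathlib

section
/- Let p and q be coprime positive integers with q ≡ 2 (mod 4) and q > 2, let m be an integer, and let φ be an integer with p·φ ≡ 1 (mod q/2). Then G(-p, 2m+1, q) · conj(G(-p, 2m-1, q)) = 2q · exp(2πi φ m/(q/2)). -/
/-- The generalized quadratic Gauss sum
`G(a, b, c) = ∑_{l=0}^{c-1} exp(2πi(a l² + b l)/c)`. -/
noncomputable def gaussG (a b : ℤ) (c : ℕ) : ℂ :=
  ∑ l ∈ Finset.range c,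
    Complex.exp (2 * (Real.pi : ℂ) * Complex.I *
      ((a : ℂ) * (l : ℂ) ^ 2 + (b : ℂ) * (l : ℂ)) / (c : ℂ))

/-- The generalized quadratic Gauss sum as a character sum over `ZMod c`. -/
theorem gaussG_eq_sum_stdAddChar (a b : ℤ) (c : ℕ) [NeZero c] :
    gaussG a b c = ∑ x : ZMod c, ZMod.stdAddChar ((a : ZMod c) * x ^ 2 + (b : ZMod c) * x) := by
  unfold gaussG
  refine Finset.sum_bij' (fun l _ => (l : ZMod c)) (fun x _ => x.val)
    (fun _ _ => Finset.mem_univ _) (fun x _ => Finset.mem_range.2 x.val_lt)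
    (fun l hl => ZMod.val_cast_of_lt (Finset.mem_range.1 hl))
    (fun x _ => ZMod.natCast_zmod_val x) fun l _ => ?_
  have h := ZMod.stdAddChar_coe (N := c) (a * (l : ℤ) ^ 2 + b * (l : ℤ))
  push_cast at h
  rw [h]

/-- The product of one quadratic Gauss sum with the conjugate of another one, with linear
coefficients differing by `b - b'`, reduces to a sum over the solutions of a linear congruence. -/
theorem gaussG_mul_conj_gaussG (a b b' : ℤ) (c : ℕ) [NeZero c] :
    gaussG a b c * (starRingEnd ℂ) (gaussG a b' c) =
      (c : ℂ) * ∑ d : ZMod c with 2 * (a : ZMod c) * d + (b - b' : ZMod c) = 0,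
        ZMod.stdAddChar ((a : ZMod c) * d ^ 2 + (b : ZMod c) * d) := by
  have inner (d : ZMod c) :
      ∑ k : ZMod c, (ZMod.stdAddChar (k * (2 * (a : ZMod c) * d + (b - b' : ZMod c))) : ℂ) =
        if 2 * (a : ZMod c) * d + (b - b' : ZMod c) = 0 then (c : ℂ) else 0 := by
    rw [AddChar.sum_mulShift _ (ZMod.isPrimitive_stdAddChar c), ZMod.card]
    push_cast
    rfl
  rw [gaussG_eq_sum_stdAddChar, gaussG_eq_sum_stdAddChar, map_sum, Finset.mul_sum]
  calc
    _ = ∑ k : ZMod c, ∑ d : ZMod c,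
        (ZMod.stdAddChar ((a : ZMod c) * d ^ 2 + (b : ZMod c) * d) : ℂ) *
          ZMod.stdAddChar (k * (2 * (a : ZMod c) * d + (b - b' : ZMod c))) := by
      refine Finset.sum_congr rfl fun k _ => ?_
      rw [Finset.sum_mul, ← Equiv.sum_comp (Equiv.addLeft k)]
      refine Finset.sum_congr rfl fun d _ => ?_
      rw [← AddChar.map_neg_eq_conj, ← AddChar.map_add_eq_mul, ← AddChar.map_add_eq_mul]
      congr 1
      simp only [Equiv.coe_addLeft]
      ring
    _ = _ := by
      rw [Finset.sum_comm, Finset.sum_filter, Finset.mul_sum]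
      refine Finset.sum_congr rfl fun d _ => ?_
      rw [← Finset.mul_sum, inner]
      split_ifs <;> ring

theorem stmt_5 (p q : ℕ) (hp : 0 < p) (hq2 : 2 < q) (hpq : Nat.Coprime p q)
    (hq4 : q % 4 = 2) (m φ : ℤ) (hφ : (p : ℤ) * φ ≡ 1 [ZMOD ((q / 2 : ℕ) : ℤ)]) :
    gaussG (-(p : ℤ)) (2 * m + 1) q * (starRingEnd ℂ) (gaussG (-(p : ℤ)) (2 * m - 1) q) =
      2 * (q : ℂ) *
        Complex.exp (2 * (Real.pi : ℂ) * Complex.I * (φ : ℂ) * (m : ℂ) / ((q / 2 : ℕ) : ℂ)) := by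
  have : NeZero q := ⟨by omega⟩
  obtain ⟨n, hn⟩ : ∃ n, q = 2 * n := ⟨q / 2, by omega⟩
  have hn2 : q / 2 = n := by omega
  have hnodd : n % 2 = 1 := by omega
  have hpodd : (p : ℤ) % 2 = 1 := by
    have : Nat.Coprime p 2 := hpq.coprime_dvd_right ⟨n, hn⟩
    have := Nat.odd_iff.1 (Nat.coprime_two_right.1 this)
    omega
  rw [hn2] at hφ ⊢
  have hqz : (q : ℤ) = 2 * n := by exact_mod_cast hn
  have hqn : (2 : ZMod q) * n = 0 := by
    have := ZMod.natCast_self q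
    rw [hn] at this ⊢
    exact_mod_cast this
  have hφ' : (2 : ZMod q) * p * φ = 2 := by
    obtain ⟨t, ht⟩ := hφ.dvd
    have h : ((1 - p * φ : ℤ) : ZMod q) = ((n * t : ℤ) : ZMod q) := by rw [ht]
    push_cast at h
    linear_combination -2 * h - t * hqn
  have hfilter : ({d : ZMod q | 2 * ((-(p : ℤ) : ℤ) : ZMod q) * d +
      (((2 * m + 1 : ℤ) : ZMod q) - ((2 * m - 1 : ℤ) : ZMod q)) = 0} : Finset (ZMod q)) =
      {(φ : ZMod q), (φ : ZMod q) + n} := by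
    ext d
    simp only [Finset.mem_filter, Finset.mem_univ, true_and, Finset.mem_insert,
      Finset.mem_singleton]
    push_cast
    constructor
    · intro h
      obtain ⟨e, rfl⟩ := ZMod.intCast_surjective d
      have h2 : ((2 * (e - φ) : ℤ) : ZMod q) = 0 := by
        push_cast
        linear_combination -(φ : ZMod q) * h - (e : ZMod q) * hφ'
      rw [ZMod.intCast_zmod_eq_zero_iff_dvd, hqz] at h2
      obtain ⟨t, ht⟩ := Int.dvd_of_mul_dvd_mul_left (by norm_num) h2
      have he : e = φ + n * t := by linarith
      subst he
      push_cast
      rcases Int.even_or_odd' t with ⟨s, rfl | rfl⟩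
      · left
        push_cast
        linear_combination (s : ZMod q) * hqn
      · right
        push_cast
        linear_combination (s : ZMod q) * hqn
    · rintro (rfl | rfl)
      · linear_combination -hφ'
      · linear_combination -hφ' - (p : ZMod q) * hqn
  have hterm (d : ℤ) (hd : (n : ℤ) ∣ 1 - p * d)
      (hdφ : (2 : ZMod q) * (d : ZMod q) = 2 * (φ : ZMod q)) :
      (ZMod.stdAddChar (((-(p : ℤ) : ℤ) : ZMod q) * (d : ZMod q) ^ 2 +
        ((2 * m + 1 : ℤ) : ZMod q) * (d : ZMod q)) : ℂ) =
      Complex.exp (2 * (Real.pi : ℂ) * Complex.I * (φ : ℂ) * (m : ℂ) / (n : ℂ)) := by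
    have hdvd : (q : ℤ) ∣ d * (1 - p * d) := by
      rw [hqz]
      refine IsCoprime.mul_dvd ?_ ?_ (hd.mul_left d)
      · exact_mod_cast (Nat.coprime_two_left.2 (Nat.odd_iff.2 hnodd))
      · rcases Int.even_or_odd d with h | h
        · exact h.two_dvd.mul_right _
        · refine Dvd.dvd.mul_left (Even.two_dvd ?_) d
          exact odd_one.sub_odd ((Int.odd_iff.2 hpodd).mul h)
    have h0 := (ZMod.intCast_zmod_eq_zero_iff_dvd _ q).2 hdvd
    have harg : ((-(p : ℤ) : ℤ) : ZMod q) * (d : ZMod q) ^ 2 +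
        ((2 * m + 1 : ℤ) : ZMod q) * (d : ZMod q) =
        ((2 * (φ * m) : ℤ) : ZMod q) := by
      push_cast at h0 ⊢
      linear_combination h0 + (m : ZMod q) * hdφ
    have hn0 : (n : ℂ) ≠ 0 := by
      have : n ≠ 0 := by omega
      exact_mod_cast this
    have hqc : (q : ℂ) = 2 * n := by exact_mod_cast hn
    rw [harg, ZMod.stdAddChar_coe, hqc]
    congr 1
    push_cast
    field_simp
  have hne : (φ : ZMod q) ≠ φ + n := by
    intro h
    have : (n : ZMod q) = 0 := by linear_combination -h
    rw [ZMod.natCast_eq_zero_iff] at this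
    have := Nat.le_of_dvd (by omega) this
    omega
  have h1 := hterm φ hφ.dvd rfl
  have h2 := hterm (φ + n) (by
    rw [show (1 - p * (φ + n) : ℤ) = (1 - p * φ) - n * p by ring]
    exact dvd_sub hφ.dvd (dvd_mul_right _ _)) (by
    push_cast
    linear_combination hqn)
  rw [Int.cast_add φ, Int.cast_natCast n] at h2
  rw [gaussG_mul_conj_gaussG, hfilter, Finset.sum_pair hne, h1, h2]
  ring
end

section
/- Let r ≥ 2 be an integer, let c be an odd positive integer, let m be an integer, and let φ₂ be an integer with c·φ₂ ≡ 1 (mod 2^r). Then G(-c, 2m, 2^r) = exp(πi φ₂ (2m)²/2^{r+1}) · (2^r | c) · (1 - i^c) · √(2^r), where (2^r | c) denotes the Jacobi symbol of 2^r over c. -/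
theorem sum_range_add_int_of_periodic {f : ℤ → ℂ} {n : ℕ} (hf : ∀ x, f (x + n) = f x) (t : ℤ) :
    ∑ l ∈ Finset.range n, f (l + t) = ∑ l ∈ Finset.range n, f l := by
  have step (t : ℤ) : ∑ l ∈ Finset.range n, f (l + (t + 1)) = ∑ l ∈ Finset.range n, f (l + t) := by
    have h₁ := Finset.sum_range_succ (fun l : ℕ => f (l + t)) n
    rw [Finset.sum_range_succ', add_comm (n : ℤ) t, hf] at h₁
    simpa [add_assoc, add_comm, add_left_comm] using h₁
  induction t with
  | zero => simp
  | succ i ih => rw [step, ih]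
  | pred i ih => rw [← ih, ← step, sub_add_cancel]

theorem sum_range_two_mul (f : ℕ → ℂ) (n : ℕ) :
    ∑ l ∈ Finset.range (2 * n), f l = ∑ l ∈ Finset.range n, (f (2 * l) + f (2 * l + 1)) := by
  induction n with
  | zero => simp
  | succ n ih =>
    rw [show 2 * (n + 1) = 2 * n + 1 + 1 by ring, Finset.sum_range_succ, Finset.sum_range_succ, ih,
      Finset.sum_range_succ, add_assoc]

theorem exp_div_eq_of_modEq {n : ℕ} (hn : n ≠ 0) {x y : ℤ} (h : x ≡ y [ZMOD n]) :
    Complex.exp (2 * (Real.pi : ℂ) * Complex.I * x / n) =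
      Complex.exp (2 * (Real.pi : ℂ) * Complex.I * y / n) := by
  obtain ⟨k, hk⟩ := h.symm.dvd
  rw [Complex.exp_eq_exp_iff_exists_int]
  refine ⟨k, ?_⟩
  obtain rfl : x = y + n * k := by linarith
  have : (n : ℂ) ≠ 0 := by exact_mod_cast hn
  push_cast
  field_simp

theorem gaussG_eq_sum_int (a b : ℤ) (n : ℕ) :
    gaussG a b n = ∑ l ∈ Finset.range n, Complex.exp (2 * (Real.pi : ℂ) * Complex.I *
      ((a * (l : ℤ) ^ 2 + b * (l : ℤ) : ℤ) : ℂ) / n) := by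
  simp [gaussG]

/-- Completing the square. -/
theorem gaussG_two_mul_eq {n : ℕ} (hn : n ≠ 0) {a u : ℤ} (hu : a * u ≡ 1 [ZMOD n]) (m : ℤ) :
    gaussG a (2 * m) n =
      Complex.exp (2 * (Real.pi : ℂ) * Complex.I * ((-(u * m ^ 2) : ℤ) : ℂ) / n) *
        gaussG a 0 n := by
  rw [gaussG_eq_sum_int a 0, ← sum_range_add_int_of_periodic
    (f := fun l => Complex.exp (2 * (Real.pi : ℂ) * Complex.I * ((a * l ^ 2 + 0 * l : ℤ) : ℂ) / n))
    (t := u * m), gaussG_eq_sum_int, Finset.mul_sum]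
  · refine Finset.sum_congr rfl fun l _ => ?_
    rw [← Complex.exp_add, ← add_div, ← mul_add, ← Int.cast_add]
    refine exp_div_eq_of_modEq hn (Int.modEq_iff_dvd.2 ?_)
    obtain ⟨k, hk⟩ := hu.symm.dvd
    refine ⟨k * (2 * l * m + u * m ^ 2), ?_⟩
    linear_combination (2 * l * m + u * m ^ 2) * hk
  · intro x
    refine exp_div_eq_of_modEq hn (Int.modEq_iff_dvd.2 ⟨-a * (2 * x + n), ?_⟩)
    ring

/-- The terms of `G(a, 0, 2n)` are invariant under `l ↦ l + n` when `n` is even. -/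
theorem gaussG_two_mul_modulus {n : ℕ} (hn : n ≠ 0) (h : Even n) (a : ℤ) :
    gaussG a 0 (2 * n) = 2 * ∑ l ∈ Finset.range n, Complex.exp (2 * (Real.pi : ℂ) * Complex.I *
      ((a * (l : ℤ) ^ 2 : ℤ) : ℂ) / (2 * n : ℕ)) := by
  rw [gaussG_eq_sum_int, two_mul n, Finset.sum_range_add, ← two_mul n, two_mul (Finset.sum _ _)]
  congr 1
  · simp
  · refine Finset.sum_congr rfl fun l _ => exp_div_eq_of_modEq (by positivity) ?_
    obtain ⟨k, rfl⟩ := h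
    refine Int.modEq_iff_dvd.2 ⟨-a * (l + k), ?_⟩
    push_cast
    ring

theorem gaussG_zero_four_mul {n : ℕ} (hn : n ≠ 0) (h : 4 ∣ n) {a : ℤ} (ha : Odd a) :
    gaussG a 0 (4 * n) = 2 * gaussG a 0 n := by
  obtain ⟨k, rfl⟩ := h
  have hk : k ≠ 0 := by rintro rfl; simp at hn
  rw [show 4 * (4 * k) = 2 * (2 * (4 * k)) by ring, gaussG_two_mul_modulus (by positivity) (by simp),
    show 4 * k = 2 * (2 * k) by ring, gaussG_two_mul_modulus (by positivity) (by simp)]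
  congr 1
  rw [two_mul (2 * (2 * k)), Finset.sum_range_add, ← two_mul (2 * (2 * k)),
    ← Finset.sum_add_distrib, sum_range_two_mul, Finset.mul_sum]
  refine Finset.sum_congr rfl fun l _ => ?_
  have hodd : Complex.exp (2 * (Real.pi : ℂ) * Complex.I *
        ((a * ((2 * (2 * k) + (2 * l + 1) : ℕ) : ℤ) ^ 2 : ℤ) : ℂ) / (2 * (2 * (2 * (2 * k))) : ℕ)) =
      -Complex.exp (2 * (Real.pi : ℂ) * Complex.I *
        ((a * ((2 * l + 1 : ℕ) : ℤ) ^ 2 : ℤ) : ℂ) / (2 * (2 * (2 * (2 * k))) : ℕ)) := by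
    obtain ⟨b, rfl⟩ := ha
    rw [← Complex.exp_add_pi_mul_I, Complex.exp_eq_exp_iff_exists_int]
    refine ⟨(2 * b + 1) * (l + k) + b, ?_⟩
    push_cast
    field_simp
    ring
  have heven : Complex.exp (2 * (Real.pi : ℂ) * Complex.I *
        ((a * ((2 * (2 * k) + 2 * l : ℕ) : ℤ) ^ 2 : ℤ) : ℂ) / (2 * (2 * (2 * (2 * k))) : ℕ)) =
      Complex.exp (2 * (Real.pi : ℂ) * Complex.I *
        ((a * ((2 * l : ℕ) : ℤ) ^ 2 : ℤ) : ℂ) / (2 * (2 * (2 * (2 * k))) : ℕ)) := by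
    refine exp_div_eq_of_modEq (by positivity) (Int.modEq_iff_dvd.2 ⟨-a * (l + k), ?_⟩)
    push_cast
    ring
  have hscale : Complex.exp (2 * (Real.pi : ℂ) * Complex.I *
        ((a * ((2 * l : ℕ) : ℤ) ^ 2 : ℤ) : ℂ) / (2 * (2 * (2 * (2 * k))) : ℕ)) =
      Complex.exp (2 * (Real.pi : ℂ) * Complex.I *
        ((a * (l : ℤ) ^ 2 : ℤ) : ℂ) / (2 * (2 * k) : ℕ)) := by
    congr 1
    push_cast
    field_simp
  rw [hodd, heven, hscale]
  ring

theorem gaussG_neg_zero_four {c : ℕ} (hc : Odd c) :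
    gaussG (-(c : ℤ)) 0 4 = 2 * (1 - Complex.I ^ c) := by
  have hω : Complex.exp (2 * (Real.pi : ℂ) * Complex.I * ((-c : ℤ) : ℂ) / (2 * 2 : ℕ)) =
      -Complex.I ^ c := by
    rw [← hc.neg_pow, ← Complex.exp_neg_pi_div_two_mul_I, ← Complex.exp_nat_mul]
    congr 1
    push_cast
    ring
  rw [show 4 = 2 * 2 by rfl, gaussG_two_mul_modulus two_ne_zero even_two, Finset.sum_range_succ,
    Finset.sum_range_one]
  simp only [Nat.cast_one, one_pow, mul_one, hω]
  simp [sub_eq_add_neg]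

theorem gaussG_neg_zero_eight {c : ℕ} (hc : Odd c) :
    gaussG (-(c : ℤ)) 0 8 =
      (jacobiSym 2 c : ℂ) * (1 - Complex.I ^ c) * (2 * (Real.sqrt 2 : ℂ)) := by
  set ω : ℂ := Complex.exp (-(Real.pi / 4 : ℝ) * Complex.I) with hω
  have hωval : ω = (Real.sqrt 2 : ℂ) / 2 * (1 - Complex.I) := by
    rw [hω, ← Complex.ofReal_neg, Complex.exp_mul_I, ← Complex.ofReal_cos, ← Complex.ofReal_sin,
      Real.cos_neg, Real.sin_neg, Real.cos_pi_div_four, Real.sin_pi_div_four]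
    push_cast
    ring
  have hsq : (Real.sqrt 2 : ℂ) ^ 2 = 2 := by
    rw [← Complex.ofReal_pow, Real.sq_sqrt (by norm_num)]; norm_num
  have hω2 : ω ^ 2 = -Complex.I := by
    rw [hωval]
    linear_combination (1 - Complex.I) ^ 2 / 4 * hsq + Complex.I_sq / 2
  have hω4 : ω ^ 4 = -1 := by
    linear_combination (ω ^ 2 - Complex.I) * hω2 + Complex.I_sq
  have hterm (x : ℕ) : Complex.exp (2 * (Real.pi : ℂ) * Complex.I *
      ((-c * (x : ℤ) ^ 2 : ℤ) : ℂ) / (2 * 4 : ℕ)) = (ω ^ c) ^ (x ^ 2) := by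
    rw [hω, ← pow_mul, ← Complex.exp_nat_mul]
    congr 1
    push_cast
    ring
  have hsum : gaussG (-(c : ℤ)) 0 8 = 4 * ω ^ c := by
    have hωc4 : (ω ^ c) ^ 4 = -1 := by rw [← pow_mul, mul_comm, pow_mul, hω4, hc.neg_one_pow]
    rw [show 8 = 2 * 4 by rfl, gaussG_two_mul_modulus four_ne_zero ⟨2, rfl⟩]
    simp only [hterm, Finset.sum_range_succ, Finset.sum_range_zero]
    linear_combination (2 + 2 * ω ^ c * ((ω ^ c) ^ 4 - 1)) * hωc4
  have hω8 : ω ^ 8 = 1 := by rw [show 8 = 4 * 2 by rfl, pow_mul, hω4]; norm_num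
  have hI8 : Complex.I ^ 8 = 1 := by rw [show 8 = 4 * 2 by rfl, pow_mul, Complex.I_pow_four, one_pow]
  have hI3 : Complex.I ^ 3 = -Complex.I := Complex.I_pow_three
  have hmod : c % 8 = 1 ∨ c % 8 = 3 ∨ c % 8 = 5 ∨ c % 8 = 7 := by
    have := Nat.odd_iff.1 hc
    omega
  rw [hsum, jacobiSym.at_two hc, ZMod.χ₈_nat_eq_if_mod_eight, pow_eq_pow_mod c hω8,
    pow_eq_pow_mod c hI8, if_neg (by have := Nat.odd_iff.1 hc; omega)]
  have hI5 : Complex.I ^ 5 = Complex.I := by rw [pow_succ, Complex.I_pow_four, one_mul]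
  have hI7 : Complex.I ^ 7 = -Complex.I := by
    rw [show 7 = 4 + 3 by rfl, pow_add, Complex.I_pow_four, one_mul, hI3]
  have hω3 : ω ^ 3 = -Complex.I * ω := by rw [pow_succ, hω2]
  have hω5 : ω ^ 5 = -ω := by rw [pow_succ, hω4]; ring
  have hω7 : ω ^ 7 = Complex.I * ω := by
    rw [show 7 = 4 + 3 by rfl, pow_add, hω4, hω3]; ring
  rcases hmod with h | h | h | h <;> rw [h] <;> norm_num [hI3, hI5, hI7, hω3, hω5, hω7] <;>
    rw [hωval]
  · ring
  · linear_combination 2 * (Real.sqrt 2 : ℂ) * Complex.I_sq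
  · ring
  · linear_combination -2 * (Real.sqrt 2 : ℂ) * Complex.I_sq

theorem gaussG_neg_zero_two_pow {c : ℕ} (hc : Odd c) (s : ℕ) :
    gaussG (-(c : ℤ)) 0 (2 ^ (s + 2)) =
      (jacobiSym ((2 ^ (s + 2) : ℕ) : ℤ) c : ℂ) * (1 - Complex.I ^ c) *
        (Real.sqrt (2 ^ (s + 2)) : ℂ) := by
  have hJ : (jacobiSym 2 c : ℂ) ^ 2 = 1 := by
    have h := jacobiSym.sq_one (a := 2) (b := c) (Int.isCoprime_iff_gcd_eq_one.1
      (by exact_mod_cast (Nat.isCoprime_iff_coprime.2 (Nat.coprime_two_left.2 hc))))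
    exact_mod_cast h
  have hsqrt (t : ℕ) : Real.sqrt (2 ^ (t + 2)) = 2 * Real.sqrt (2 ^ t) := by
    rw [pow_add, mul_comm, Real.sqrt_mul (by positivity), Real.sqrt_sq (by norm_num)]
  rw [hsqrt, Nat.cast_pow, Nat.cast_ofNat, jacobiSym.pow_left, Int.cast_pow,
    pow_add (jacobiSym 2 c : ℂ), hJ]
  induction s using Nat.twoStepInduction with
  | zero => rw [zero_add, show 2 ^ 2 = 4 by rfl, gaussG_neg_zero_four hc]; simp; ring
  | one => rw [show 2 ^ (1 + 2) = 8 by rfl, gaussG_neg_zero_eight hc]; simp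
  | more s ih _ =>
    rw [show 2 ^ (s + 2 + 2) = 4 * 2 ^ (s + 2) by ring,
      gaussG_zero_four_mul (by positivity) ⟨2 ^ s, by ring⟩ (by simpa using hc), ih, hsqrt,
      pow_add _ s 2, hJ]
    push_cast
    ring

theorem stmt_7 (r : ℕ) (hr : 2 ≤ r) (c : ℕ) (hc : 0 < c) (hcodd : Odd c)
    (m φ₂ : ℤ) (hφ₂ : (c : ℤ) * φ₂ ≡ 1 [ZMOD ((2 ^ r : ℕ) : ℤ)]) :
    gaussG (-(c : ℤ)) (2 * m) (2 ^ r) =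
      Complex.exp ((Real.pi : ℂ) * Complex.I * (φ₂ : ℂ) * (2 * (m : ℂ)) ^ 2 / (2 ^ (r + 1) : ℂ)) *
        (jacobiSym ((2 ^ r : ℕ) : ℤ) c : ℂ) * (1 - Complex.I ^ c) *
          (Real.sqrt (2 ^ r) : ℂ) := by
  obtain ⟨s, rfl⟩ := Nat.exists_eq_add_of_le' hr
  rw [gaussG_two_mul_eq (by positivity) (u := -φ₂) (by simpa using hφ₂),
    gaussG_neg_zero_two_pow hcodd, ← mul_assoc, ← mul_assoc]
  congr 4
  push_cast
  field_simp
  ring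
end
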